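/- Let A = (a_{ij}) be an n×n Cartan matrix, let 1 ≤ m < n, set I = {1,…,m} and J = {m+1,…,n}, and write A_I = (a_{kl})_{k,l∈I} (itself an m×m Cartan matrix). If det A_I ≠ 0, then the ring of invariants P_I = ℚ[ω_1,…,ω_n]^{W_I(A)} is isomorphic as a ℚ-algebra to Q_I ⊗_ℚ ℚ[ω_{m+1},…,ω_n], where Q_I = ℚ[x_1,…,x_m]^{W(A_I)} is the ring of invariants of the Weyl group W(A_I) of the Cartan matrix A_I acting on its own weight polynomial ring ℚ[x_1,…,x_m]. -/

import Mathlib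

set_option synthInstance.maxHeartbeats 1000000
set_option maxHeartbeats 1000000

def IsCartanMatrix {ι : Type*} (A : Matrix ι ι ℤ) : Prop :=
  (∀ i, A i i = 2) ∧ (∀ i j, i ≠ j → A i j ≤ 0) ∧ (∀ i j, A i j = 0 → A j i = 0)

/-- The matrix `S_i = I - (A e_i) eᵢᵀ` of the `i`-th Weyl reflection. -/
def weylMatrix {ι : Type*} [DecidableEq ι] (A : Matrix ι ι ℤ) (i : ι) : Matrix ι ι ℚ :=
  1 - Matrix.of (fun k l => if l = i then (A k i : ℚ) else 0)

/-- `W_I(A)`, the subgroup of `GL_n(ℚ)` generated by the Weyl reflections `σ_i`, `i ∈ I`. -/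
def weylGroup {ι : Type*} [Fintype ι] [DecidableEq ι] (A : Matrix ι ι ℤ) (I : Set ι) :
    Subgroup (GL ι ℚ) :=
  Subgroup.closure {g : GL ι ℚ | ∃ i ∈ I, (g : Matrix ι ι ℚ) = weylMatrix A i}

/-- The action of a matrix `g` on the polynomial ring `ℚ[ω_1,…,ω_n]` by the `ℚ`-algebra
endomorphism extending its linear action on the span of the variables:
`ω_j ↦ ∑ₖ g_{kj} ω_k`. -/
noncomputable def matAct {ι : Type*} [Fintype ι] (g : Matrix ι ι ℚ) :
    MvPolynomial ι ℚ →ₐ[ℚ] MvPolynomial ι ℚ :=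
  MvPolynomial.aeval (fun j => ∑ k, g k j • MvPolynomial.X k)

/-- `P_I = P^{W_I(A)}`, the fixed subalgebra of the polynomial ring `ℚ[ω_1,…,ω_n]` under
the action of `W_I(A)`. -/
noncomputable def fixedAlg {ι : Type*} [Fintype ι] [DecidableEq ι] (A : Matrix ι ι ℤ)
    (I : Set ι) : Subalgebra ℚ (MvPolynomial ι ℚ) where
  carrier := {p | ∀ g ∈ weylGroup A I, matAct (g : Matrix ι ι ℚ) p = p}
  mul_mem' := fun hp hq g hg => by rw [map_mul, hp g hg, hq g hg]
  add_mem' := fun hp hq g hg => by rw [map_add, hp g hg, hq g hg]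
  algebraMap_mem' := fun r g hg => by exact AlgHom.commutes _ r

theorem matAct_X {ι : Type*} [Fintype ι] (g : Matrix ι ι ℚ) (j : ι) :
    matAct g (MvPolynomial.X j) = ∑ k, g k j • MvPolynomial.X k := by
  simp [matAct]

theorem matAct_one {ι : Type*} [Fintype ι] [DecidableEq ι] :
    matAct (1 : Matrix ι ι ℚ) = AlgHom.id ℚ _ := by
  ext1 j
  simp [matAct_X, Matrix.one_apply, ite_smul]

theorem matAct_mul {ι : Type*} [Fintype ι] (g h : Matrix ι ι ℚ) :
    matAct (g * h) = (matAct g).comp (matAct h) := by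
  ext1 j
  simp only [AlgHom.comp_apply, matAct_X, map_sum, map_smul, Matrix.mul_apply, Finset.smul_sum,
    Finset.sum_smul, smul_smul]
  rw [Finset.sum_comm]
  simp only [mul_comm]

theorem matAct_mul_apply {ι : Type*} [Fintype ι] (g h : Matrix ι ι ℚ) (p : MvPolynomial ι ℚ) :
    matAct (g * h) p = matAct g (matAct h p) := by
  rw [matAct_mul, AlgHom.comp_apply]

theorem weylMatrix_mul_self {ι : Type*} [Fintype ι] [DecidableEq ι] {A : Matrix ι ι ℤ} {i : ι}
    (h : A i i = 2) : weylMatrix A i * weylMatrix A i = 1 := by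
  have key : ∀ N : Matrix ι ι ℚ, N * N = N + N → (1 - N) * (1 - N) = 1 := by
    intro N hN
    rw [sub_mul, mul_sub, mul_sub, hN, one_mul, one_mul, mul_one]
    abel
  refine key _ ?_
  ext k l
  by_cases hl : l = i <;> simp [Matrix.mul_apply, h, mul_two, hl]

/-- A polynomial is invariant under `W_I(A)` once it is invariant under the reflections. -/
theorem mem_fixedAlg_iff {ι : Type*} [Fintype ι] [DecidableEq ι] {A : Matrix ι ι ℤ}
    (h : ∀ i, A i i = 2) {I : Set ι} {p : MvPolynomial ι ℚ} :
    p ∈ fixedAlg A I ↔ ∀ i ∈ I, matAct (weylMatrix A i) p = p := by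
  constructor
  · intro hp i hi
    exact hp ⟨_, _, weylMatrix_mul_self (h i), weylMatrix_mul_self (h i)⟩
      (Subgroup.subset_closure ⟨i, hi, rfl⟩)
  · intro hp g hg
    induction hg using Subgroup.closure_induction with
    | mem g hg =>
      obtain ⟨i, hi, hgi⟩ := hg
      rw [hgi, hp i hi]
    | one => rw [Units.val_one, matAct_one, AlgHom.id_apply]
    | mul g h _ _ ihg ihh => rw [Units.val_mul, matAct_mul_apply, ihh, ihg]
    | inv g _ ih =>
      conv_lhs => rw [← ih]
      rw [← matAct_mul_apply, Units.inv_mul, matAct_one, AlgHom.id_apply]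

/-- The isomorphism `ℚ[x_ι][y_κ] ≃ ℚ[x_ι, y_κ]`. -/
noncomputable def iterEquiv (ι κ : Type*) :
    MvPolynomial κ (MvPolynomial ι ℚ) ≃ₐ[ℚ] MvPolynomial (ι ⊕ κ) ℚ :=
  (MvPolynomial.sumAlgEquiv ℚ κ ι).symm.trans (MvPolynomial.renameEquiv ℚ (Equiv.sumComm κ ι))

theorem iterEquiv_X {ι κ : Type*} (j : κ) :
    iterEquiv ι κ (MvPolynomial.X j) = MvPolynomial.X (Sum.inr j) := by
  simp [iterEquiv]

theorem iterEquiv_C {ι κ : Type*} (p : MvPolynomial ι ℚ) :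
    iterEquiv ι κ (MvPolynomial.C p) = MvPolynomial.rename Sum.inl p := by
  induction p using MvPolynomial.induction_on with
  | C a => simp [iterEquiv]
  | add p q hp hq => simp [hp, hq]
  | mul_X p i hp => rw [map_mul, map_mul, hp]; simp [iterEquiv]

theorem matAct_rename_inl {ι κ : Type*} [Fintype ι] [Fintype κ] [DecidableEq κ]
    (M : Matrix ι ι ℚ) (p : MvPolynomial ι ℚ) :
    matAct (Matrix.fromBlocks M 0 0 (1 : Matrix κ κ ℚ)) (MvPolynomial.rename Sum.inl p) =
      MvPolynomial.rename Sum.inl (matAct M p) := by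
  induction p using MvPolynomial.induction_on with
  | C a => simp [matAct]
  | add p q hp hq => simp [hp, hq]
  | mul_X p i hp => simp [hp, matAct_X]

/-- A block matrix `diag(M, 1)` acts on `ℚ[x_ι, y_κ]` through the coefficients in `ℚ[x_ι]`. -/
theorem matAct_iterEquiv {ι κ : Type*} [Fintype ι] [Fintype κ] [DecidableEq κ]
    (M : Matrix ι ι ℚ) (p : MvPolynomial κ (MvPolynomial ι ℚ)) :
    matAct (Matrix.fromBlocks M 0 0 (1 : Matrix κ κ ℚ)) (iterEquiv ι κ p) =
      iterEquiv ι κ (MvPolynomial.map (matAct M : MvPolynomial ι ℚ →+* MvPolynomial ι ℚ) p) := by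
  induction p using MvPolynomial.induction_on with
  | C a => simp [iterEquiv_C, matAct_rename_inl]
  | add p q hp hq => simp only [map_add, hp, hq]
  | mul_X p i hp =>
    simp [hp, iterEquiv_X, matAct_X, Matrix.one_apply, ite_smul]

theorem weylMatrix_mul_fromBlocks {ι κ : Type*} [Fintype ι] [DecidableEq ι] [Fintype κ]
    [DecidableEq κ] (A : Matrix (ι ⊕ κ) (ι ⊕ κ) ℤ) {C : Matrix κ ι ℚ}
    (hC : C * A.toBlocks₁₁.map (Int.cast : ℤ → ℚ) = A.toBlocks₂₁.map Int.cast) (i : ι) :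
    weylMatrix A (Sum.inl i) * Matrix.fromBlocks 1 0 C 1 =
      Matrix.fromBlocks 1 0 C 1 * Matrix.fromBlocks (weylMatrix A.toBlocks₁₁ i) 0 0 1 := by
  have hS : weylMatrix A (Sum.inl i) = Matrix.fromBlocks (weylMatrix A.toBlocks₁₁ i) 0
      (-Matrix.of fun k l => if l = i then (A (Sum.inr k) (Sum.inl i) : ℚ) else 0) 1 := by
    ext (k | k) (l | l) <;> simp [weylMatrix, Matrix.one_apply, Matrix.toBlocks₁₁]
  rw [hS, Matrix.fromBlocks_multiply, Matrix.fromBlocks_multiply]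
  congr 1
  · simp
  · simp
  · ext k l
    have h := congrFun (congrFun hC k) i
    simp only [Matrix.mul_apply, Matrix.map_apply, Matrix.toBlocks₁₁, Matrix.toBlocks₂₁,
      Matrix.of_apply] at h
    by_cases hl : l = i <;>
      simp [weylMatrix, mul_sub, Matrix.mul_apply, Matrix.toBlocks₁₁, Matrix.one_apply, hl, h]
    ring
  · simp

theorem map_eq_self_iff_mem_range {κ R : Type*} [CommRing R] [Algebra ℚ R] (Q : Subalgebra ℚ R)
    {α : Type*} (f : α → R →+* R) (hQ : ∀ r, r ∈ Q ↔ ∀ a, f a r = r) (p : MvPolynomial κ R) :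
    (∀ a, MvPolynomial.map (f a) p = p) ↔ p ∈ (MvPolynomial.mapAlgHom (σ := κ) Q.val).range := by
  have hmem : p ∈ (MvPolynomial.mapAlgHom (σ := κ) Q.val).range ↔ ∀ n, p.coeff n ∈ Q := by
    rw [← Subalgebra.mem_toSubmodule, MvPolynomial.range_mapAlgHom]
    simp [MvPolynomial.mem_coeffsIn]
  simp only [hmem, hQ, MvPolynomial.ext_iff, MvPolynomial.coeff_map]
  exact forall_comm

/-- If `det A_I ≠ 0`, then the ring of invariants `P_I = ℚ[ω_1,…,ω_n]^{W_I(A)}` is isomorphic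
as a `ℚ`-algebra to `Q_I ⊗_ℚ ℚ[ω_{m+1},…,ω_n]`, where `Q_I = ℚ[x_1,…,x_m]^{W(A_I)}`. Here
`n = m + k`, `I = {1,…,m}`, `J = {m+1,…,n}`, modelled by the index type `Fin m ⊕ Fin k`. -/
theorem fixedAlg_iso_tensor_of_det_ne_zero {m k : ℕ} (hm : 0 < m) (hk : 0 < k)
    (A : Matrix (Fin m ⊕ Fin k) (Fin m ⊕ Fin k) ℤ) (hA : IsCartanMatrix A)
    (hdet : A.toBlocks₁₁.det ≠ 0) :
    Nonempty ((fixedAlg A (Set.range Sum.inl)) ≃ₐ[ℚ]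
      TensorProduct ℚ (fixedAlg A.toBlocks₁₁ (Set.univ : Set (Fin m)))
        (MvPolynomial (Fin k) ℚ)) := by
  have hdiag : ∀ i, A.toBlocks₁₁ i i = 2 := fun i => hA.1 (Sum.inl i)
  let B : Matrix (Fin m) (Fin m) ℚ := A.toBlocks₁₁.map Int.cast
  let D : Matrix (Fin k) (Fin m) ℚ := A.toBlocks₂₁.map Int.cast
  have hunit : IsUnit B.det := by
    rw [isUnit_iff_ne_zero, ← Int.cast_det]
    exact_mod_cast hdet
  obtain ⟨C, hC⟩ : ∃ C : Matrix (Fin k) (Fin m) ℚ, C * B = D :=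
    ⟨D * B⁻¹, by rw [Matrix.mul_assoc, Matrix.nonsing_inv_mul _ hunit, Matrix.mul_one]⟩
  set T : Matrix (Fin m ⊕ Fin k) (Fin m ⊕ Fin k) ℚ := Matrix.fromBlocks 1 0 C 1 with hT
  set T' : Matrix (Fin m ⊕ Fin k) (Fin m ⊕ Fin k) ℚ := Matrix.fromBlocks 1 0 (-C) 1 with hT'
  have hTT' : T * T' = 1 := by simp [hT, hT', Matrix.fromBlocks_multiply]
  have hT'T : T' * T = 1 := by simp [hT, hT', Matrix.fromBlocks_multiply]
  let τ : MvPolynomial (Fin m ⊕ Fin k) ℚ ≃ₐ[ℚ] MvPolynomial (Fin m ⊕ Fin k) ℚ :=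
    AlgEquiv.ofAlgHom (matAct T) (matAct T') (by rw [← matAct_mul, hTT', matAct_one])
      (by rw [← matAct_mul, hT'T, matAct_one])
  let e := (iterEquiv (Fin m) (Fin k)).trans τ
  let Q := fixedAlg A.toBlocks₁₁ (Set.univ : Set (Fin m))
  have hact (i : Fin m) (p) : matAct (weylMatrix A (Sum.inl i)) (e p) =
      e (MvPolynomial.map (matAct (weylMatrix A.toBlocks₁₁ i) : _ →+* _) p) := by
    change matAct _ (matAct T (iterEquiv _ _ p)) = matAct T (iterEquiv _ _ _)
    rw [← matAct_mul_apply, weylMatrix_mul_fromBlocks A hC, matAct_mul_apply, matAct_iterEquiv]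
  let Φ : MvPolynomial (Fin k) Q →ₐ[ℚ] MvPolynomial (Fin m ⊕ Fin k) ℚ :=
    (e : _ →ₐ[ℚ] _).comp (MvPolynomial.mapAlgHom Q.val)
  have hinj : Function.Injective Φ :=
    e.injective.comp (MvPolynomial.map_injective _ Subtype.val_injective)
  have hrange : Φ.range = fixedAlg A (Set.range Sum.inl) := by
    ext q
    obtain ⟨p, rfl⟩ := e.surjective q
    have hp := map_eq_self_iff_mem_range (κ := Fin k) Q
      (fun i => (matAct (weylMatrix A.toBlocks₁₁ i) : _ →+* _))
      (fun r => by simpa using mem_fixedAlg_iff hdiag (I := Set.univ) (p := r)) p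
    rw [mem_fixedAlg_iff hA.1, Set.forall_mem_range]
    simp only [hact, e.injective.eq_iff]
    rw [hp]
    constructor
    · rintro ⟨r, hr⟩
      exact ⟨r, e.injective hr⟩
    · rintro ⟨r, hr⟩
      exact ⟨r, congrArg e hr⟩
  exact ⟨((Subalgebra.equivOfEq _ _ hrange).symm.trans (AlgEquiv.ofInjective Φ hinj).symm).trans
    ((MvPolynomial.algebraTensorAlgEquiv ℚ Q).restrictScalars ℚ).symm⟩
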